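/- For every θ-restricted multisegment m ∈ M_θ, the bar involution of Ṽ_θ(0) satisfies: bar(P_θ(m)φ̃) ∈ P_θ(m)φ̃ + Σ_{m' ∈ M_θ, m' <_cry m} K·P_θ(m')φ̃. -/

import Mathlib

/-! Basic setup: `K = ℚ(q)` and the algebra `U_q^-(gl_∞)`. -/

noncomputable section

/-- The base field `K = ℚ(q)`. -/
abbrev K : Type := RatFunc ℚ

/-- The indeterminate `q`. -/
def q : K := RatFunc.X

/-- The `q`-integer `[n]`. -/
def qint (n : ℤ) : K := (q ^ n - q ^ (-n)) / (q - q⁻¹)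

/-- The `q`-factorial `[n]!`. -/
def qfact (n : ℕ) : K := ∏ k ∈ Finset.range n, qint (k + 1)

/-- The `q`-Serre relations defining `U_q^-(gl_∞)`; the generator indexed by `a : ℤ`
corresponds to `f_i` for the odd integer `i = 2a+1`, so that `|i - j| > 2 ↔ 1 < |a - b|`
and `|i - j| = 2 ↔ |a - b| = 1`. -/
inductive URel : FreeAlgebra K ℤ → FreeAlgebra K ℤ → Prop
  | far (a b : ℤ) (h : 1 < |a - b|) :
      URel (FreeAlgebra.ι K a * FreeAlgebra.ι K b) (FreeAlgebra.ι K b * FreeAlgebra.ι K a)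
  | serre (a b : ℤ) (h : |a - b| = 1) :
      URel (FreeAlgebra.ι K a * FreeAlgebra.ι K a * FreeAlgebra.ι K b
            + FreeAlgebra.ι K b * (FreeAlgebra.ι K a * FreeAlgebra.ι K a))
           ((q + q⁻¹) • (FreeAlgebra.ι K a * FreeAlgebra.ι K b * FreeAlgebra.ι K a))

/-- The algebra `U_q^-(gl_∞)`. -/
abbrev U : Type := RingQuot URel

/-- The generator `f_i` of `U_q^-(gl_∞)`, for an odd integer `i`. -/
def fgen (i : ℤ) : U := RingQuot.mkAlgHom K URel (FreeAlgebra.ι K ((i - 1) / 2))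

/-- `segAux i n` is the segment `⟨i, i+2n⟩`. -/
def segAux (i : ℤ) : ℕ → U
  | 0 => fgen i
  | n + 1 => segAux i n * fgen (i + 2 * (n + 1)) - q • (fgen (i + 2 * (n + 1)) * segAux i n)

/-- The segment `⟨i,j⟩ ∈ U_q^-(gl_∞)` for odd `i ≤ j`. -/
def seg (i j : ℤ) : U := segAux i ((j - i) / 2).toNat

/-- The divided power `⟨i,j⟩^{(n)}` (zero for `n < 0`). -/
def segPow (i j : ℤ) (n : ℤ) : U :=
  if n < 0 then 0 else (qfact n.toNat)⁻¹ • seg i j ^ n.toNat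

/-- The modified divided power `⟨i,j⟩^{[n]}`. -/
def segPowM (i j : ℤ) (n : ℤ) : U :=
  if i = -j then
    (if n < 0 then 0 else (∏ ν ∈ Finset.range n.toNat, qint (2 * (ν + 1)))⁻¹ • seg i j ^ n.toNat)
  else segPow i j n


open scoped Classical

/-- Multisegments as elements of the free abelian group on the segments `⟨i,j⟩`. -/
abbrev MS : Type := (ℤ × ℤ) →₀ ℤ

/-- The segment `⟨i,j⟩` viewed as a multisegment. -/
def sg (i j : ℤ) : MS := Finsupp.single (i, j) 1

/-- `m` is a multisegment: supported on pairs of odd integers `i ≤ j`,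
with nonnegative multiplicities. -/
def IsMulti (m : MS) : Prop :=
  ∀ i j : ℤ, m (i, j) ≠ 0 → Odd i ∧ Odd j ∧ i ≤ j ∧ 0 < m (i, j)

/-- `m` is a θ-restricted multisegment (`m_{i,j} = 0` unless `−j ≤ i ≤ j`). -/
def IsTheta (m : MS) : Prop :=
  ∀ i j : ℤ, m (i, j) ≠ 0 → Odd i ∧ Odd j ∧ -j ≤ i ∧ i ≤ j ∧ 0 < m (i, j)

/-- The pairs `(i,j)` in the box `[-N,N]²`, listed in decreasing PBW order,
i.e. decreasing lexicographic order in `(j,i)`. -/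
def box (N : ℕ) : List (ℤ × ℤ) :=
  (List.range (2 * N + 1)).flatMap fun a =>
    (List.range (2 * N + 1)).map fun b => (((N : ℤ) - b, (N : ℤ) - a))

/-- A bound on the support of `m`. -/
def bound (m : MS) : ℕ := m.support.sup fun p => max p.1.natAbs p.2.natAbs

/-- The product of the modified divided powers `⟨i,j⟩^{[m_{i,j}]}` over the segments
appearing in `m`, in decreasing PBW order. -/
def PthetaProd (m : MS) : U := ((box (bound m)).map fun p => segPowM p.1 p.2 (m p)).prod

/-- `P_θ(m)` for a θ-restricted multisegment `m`; it is `0` if `m` is not a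
θ-restricted multisegment. -/
def Ptheta (m : MS) : U := if IsTheta m then PthetaProd m else 0

/-- The crystal ordering `m' <_cry m` on multisegments. -/
def CryLt (m' m : MS) : Prop :=
  ∃ i0 j0 : ℤ, i0 ≤ j0 ∧ m' (i0, j0) < m (i0, j0) ∧
    (∀ i : ℤ, i < i0 → m' (i, j0) = m (i, j0)) ∧
    (∀ i j : ℤ, j0 < j → i ≤ j → m' (i, j) = m (i, j))

/-- The left ideal `Σ_k U_q^-(gl_∞)(f_k − f_{−k})` (over odd `k`). -/
def Jideal : Ideal U := Ideal.span {x : U | ∃ k : ℤ, Odd k ∧ x = fgen k - fgen (-k)}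

/-- The quotient module `Ṽ_θ(0)`. -/
abbrev Vt : Type := U ⧸ Jideal

/-- The generator `φ̃ ∈ Ṽ_θ(0)`, image of `1`. -/
def phi : Vt := Submodule.Quotient.mk 1

section Abstract

variable {k A : Type*} [Field k] [Ring A] [Algebra k A]

/-- `x` and `y` commute up to the scalar `κ`. -/
def QComm (κ : k) (x y : A) : Prop := x * y = κ • (y * x)

namespace QComm

variable {κ μ : k} {x y z : A}

lemma one_iff : QComm (1 : k) x y ↔ x * y = y * x := by simp [QComm]

lemma mul_right (h : QComm κ x y) (h' : QComm μ x z) : QComm (κ * μ) x (y * z) := by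
  unfold QComm at *
  rw [← mul_assoc, h, smul_mul_assoc, mul_assoc, h', mul_smul_comm, smul_smul, mul_assoc]

lemma sub_right (h : QComm κ x y) (h' : QComm κ x z) : QComm κ x (y - z) := by
  unfold QComm at *
  rw [mul_sub, sub_mul, h, h', smul_sub]

lemma smul_right (h : QComm κ x y) (c : k) : QComm κ x (c • y) := by
  unfold QComm at *
  rw [mul_smul_comm, smul_mul_assoc, h, smul_comm]

lemma symm (h : QComm κ x y) (hκ : κ ≠ 0) : QComm κ⁻¹ y x := by
  unfold QComm at *
  rw [h, smul_smul, inv_mul_cancel₀ hκ, one_smul]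

lemma symm_one (h : QComm (1 : k) x y) : QComm (1 : k) y x := by
  simpa using h.symm one_ne_zero

/-- Compatibility with `q`-commutators. -/
lemma qbracket (h : QComm κ x y) (h' : QComm μ x z) (c : k) :
    QComm (κ * μ) x (y * z - c • (z * y)) :=
  (h.mul_right h').sub_right ((mul_comm κ μ ▸ h'.mul_right h).smul_right c)

end QComm

variable (k A) in
/-- A family of elements of a `k`-algebra satisfying the `q`-Serre relations of type `A_∞`. -/
structure SerreFamily where
  /-- the parameter -/
  q : k
  /-- the family -/
  F : ℤ → A
  q_ne_zero : q ≠ 0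
  one_add_q_sq_ne_zero : 1 + q ^ 2 ≠ 0
  F_far {a b : ℤ} : 1 < |a - b| → F a * F b = F b * F a
  F_serre {a b : ℤ} : |a - b| = 1 →
    F a * F a * F b + F b * (F a * F a) = (q + q⁻¹) • (F a * F b * F a)

namespace SerreFamily

variable (S : SerreFamily k A)

/-- `S.Taux a n` is the `q`-commutator segment on `[a, a+n]`. -/
def Taux (a : ℤ) : ℕ → A
  | 0 => S.F a
  | n + 1 => Taux a n * S.F (a + (n + 1)) - S.q • (S.F (a + (n + 1)) * Taux a n)

/-- The segment on `[a, b]`. -/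
def T (a b : ℤ) : A := S.Taux a (b - a).toNat

lemma T_self (a : ℤ) : S.T a a = S.F a := by
  simp [T, Taux]

lemma T_succ {a b : ℤ} (h : a ≤ b) :
    S.T a (b + 1) = S.T a b * S.F (b + 1) - S.q • (S.F (b + 1) * S.T a b) := by
  obtain ⟨n, rfl⟩ := Int.le.dest h
  have h1 : (a + (n : ℤ) - a).toNat = n := by omega
  have h2 : (a + (n : ℤ) + 1 - a).toNat = n + 1 := by omega
  rw [T, T, h1, h2, Taux, add_assoc]

lemma F_F_far {a b : ℤ} (h : 1 < |a - b|) : QComm (1 : k) (S.F a) (S.F b) :=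
  QComm.one_iff.2 (S.F_far h)

lemma F_T_far_right {a b c : ℤ} (h : a ≤ b) (hc : b + 1 < c) : QComm (1 : k) (S.F c) (S.T a b) := by
  induction b, h using Int.leInduction with
  | base => rw [S.T_self]; exact S.F_F_far (by rw [abs_of_pos] <;> omega)
  | succ b hb ih =>
    have h1 := S.F_F_far (a := c) (b := b + 1) (by rw [abs_of_pos] <;> omega)
    simpa [S.T_succ hb] using (ih (by omega)).qbracket h1 S.q

lemma F_T_far_left {a b c : ℤ} (h : a ≤ b) (hc : c < a - 1) : QComm (1 : k) (S.F c) (S.T a b) := by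
  induction b, h using Int.leInduction with
  | base => rw [S.T_self]; exact S.F_F_far (by rw [abs_of_neg] <;> omega)
  | succ b hb ih =>
    have h1 := S.F_F_far (a := c) (b := b + 1) (by rw [abs_of_neg] <;> omega)
    simpa [S.T_succ hb] using ih.qbracket h1 S.q

/-- The segments can also be built by adding generators on the left. -/
lemma T_left {a b : ℤ} (h : a < b) :
    S.T a b = S.F a * S.T (a + 1) b - S.q • (S.T (a + 1) b * S.F a) := by
  have h : a + 1 ≤ b := h
  induction b, h using Int.leInduction with
  | base => rw [S.T_succ le_rfl, S.T_self, S.T_self]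
  | succ b hb ih =>
    have h1 : S.F a * S.F (b + 1) = S.F (b + 1) * S.F a := S.F_far (by rw [abs_of_neg] <;> omega)
    rw [S.T_succ (by omega : a ≤ b), S.T_succ hb, ih (by omega)]
    simp only [mul_sub, sub_mul, mul_smul_comm, smul_mul_assoc, smul_sub, mul_assoc, h1]
    simp only [← mul_assoc, h1]
    abel

lemma F_T_first {a b : ℤ} (h : a < b) : QComm S.q⁻¹ (S.F a) (S.T a b) := by
  have h : a + 1 ≤ b := h
  have hq := S.q_ne_zero
  induction b, h using Int.leInduction with
  | base =>
    have h := S.F_serre (a := a) (b := a + 1) (by simp)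
    rw [S.T_succ le_rfl, S.T_self, QComm]
    simp only [mul_sub, sub_mul, mul_smul_comm, smul_mul_assoc, smul_sub, mul_assoc, smul_smul,
      inv_mul_cancel₀ hq, one_smul] at h ⊢
    rw [← sub_eq_zero] at h ⊢
    rw [← h]
    module
  | succ b hb ih =>
    have h1 := S.F_F_far (a := a) (b := b + 1) (by rw [abs_of_neg] <;> omega)
    simpa [S.T_succ (by omega : a ≤ b)] using (ih (by omega)).qbracket h1 S.q

lemma F_T_last {a b : ℤ} (h : a < b) : QComm S.q (S.F b) (S.T a b) := by
  have h : a ≤ b - 1 := by omega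
  have hq := S.q_ne_zero
  induction a, h using Int.leInductionDown with
  | base =>
    have h := S.F_serre (a := b) (b := b - 1) (by simp)
    have h2 := S.T_succ (le_refl (b - 1))
    rw [sub_add_cancel, S.T_self] at h2
    rw [h2, ← inv_inv S.q]
    refine QComm.symm ?_ (inv_ne_zero hq)
    rw [inv_inv, QComm]
    simp only [mul_sub, sub_mul, mul_smul_comm, smul_mul_assoc, smul_sub, mul_assoc, smul_smul,
      inv_mul_cancel₀ hq, one_smul] at h ⊢
    rw [← sub_eq_zero] at h ⊢
    rw [← h]
    module
  | pred a ha ih =>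
    have h1 := S.F_F_far (a := b) (b := a - 1) (by rw [abs_of_pos] <;> omega)
    simpa [S.T_left (by omega : a - 1 < b)] using h1.qbracket (ih (by omega)) S.q

lemma F_T_three (c : ℤ) : QComm (1 : k) (S.F c) (S.T (c - 1) (c + 1)) := by
  have hq := S.q_ne_zero
  have hs := S.one_add_q_sq_ne_zero
  have e1 : S.T (c - 1) (c + 1) = _ := S.T_succ (by omega : c - 1 ≤ c)
  have e2 : S.T (c - 1) (c + 1) = _ := S.T_left (by omega : c - 1 < c + 1)
  have e3 : S.T (c - 1) c = _ := S.T_left (by omega : c - 1 < c)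
  have e4 := S.T_succ (le_refl c)
  have e5 := (S.F_T_first (by omega : c < c + 1)).symm (inv_ne_zero hq)
  have e6 := S.F_T_last (by omega : c - 1 < c)
  rw [sub_add_cancel] at e2
  rw [sub_add_cancel, S.T_self] at e3
  rw [S.T_self] at e4
  rw [QComm, inv_inv] at e5
  rw [QComm] at e6
  set t := S.T (c - 1) (c + 1)
  set x := S.F (c - 1)
  set y := S.F c
  set z := S.F (c + 1)
  set x' := S.T (c - 1) c
  set z' := S.T c (c + 1)
  have e5' : ∀ w, z' * (y * w) = S.q • (y * (z' * w)) := fun w => by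
    rw [← mul_assoc, e5, smul_mul_assoc, mul_assoc]
  have e6' : ∀ w, y * (x' * w) = S.q • (x' * (y * w)) := fun w => by
    rw [← mul_assoc, e6, smul_mul_assoc, mul_assoc]
  have h1 : t * y - S.q ^ 2 • (y * t) = S.q • (x' * z' - z' * x') := by
    rw [e2, e3]
    simp only [mul_sub, sub_mul, mul_smul_comm, smul_mul_assoc, smul_sub, mul_assoc, smul_smul,
      e5, e5']
    module
  have h2 : y * t - S.q ^ 2 • (t * y) = S.q • (x' * z' - z' * x') := by
    rw [e1, e4]
    simp only [mul_sub, sub_mul, mul_smul_comm, smul_mul_assoc, smul_sub, mul_assoc, smul_smul,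
      e6, e6']
    module
  have h3 : (1 + S.q ^ 2) • (y * t - t * y) = 0 := by
    rw [← sub_eq_zero.2 (h2.trans h1.symm)]
    module
  rw [QComm.one_iff]
  exact sub_eq_zero.1 ((smul_eq_zero.1 h3).resolve_left hs)

lemma F_T_middle {a b c : ℤ} (hac : a < c) (hcb : c < b) : QComm (1 : k) (S.F c) (S.T a b) := by
  have hcb : c + 1 ≤ b := hcb
  have hac : a ≤ c - 1 := by omega
  induction b, hcb using Int.leInduction with
  | base =>
    induction a, hac using Int.leInductionDown with
    | base => exact S.F_T_three c
    | pred a ha ih =>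
      have h1 := S.F_F_far (a := c) (b := a - 1) (by rw [abs_of_pos] <;> omega)
      simpa [S.T_left (by omega : a - 1 < c + 1)] using h1.qbracket (ih (by omega)) S.q
  | succ b hb ih =>
    have h1 := S.F_F_far (a := c) (b := b + 1) (by rw [abs_of_neg] <;> omega)
    simpa [S.T_succ (by omega : a ≤ b)] using (ih (by omega)).qbracket h1 S.q

lemma T_T_row {a b c : ℤ} (hac : a < c) (hcb : c ≤ b) : QComm S.q⁻¹ (S.T a b) (S.T c b) := by
  induction c, hcb using Int.leInductionDown with
  | base => rw [S.T_self]; exact (S.F_T_last hac).symm S.q_ne_zero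
  | pred c hc ih =>
    have h1 := (S.F_T_middle (a := a) (b := b) (c := c - 1) (by omega) (by omega)).symm_one
    simpa [S.T_left (by omega : c - 1 < b)] using h1.qbracket (ih (by omega)) S.q

/-- Any two segments with the same right end commute up to a nonzero scalar. -/
lemma exists_T_T_row {a b c : ℤ} (ha : a ≤ b) (hc : c ≤ b) :
    ∃ κ : k, κ ≠ 0 ∧ QComm κ (S.T a b) (S.T c b) := by
  rcases lt_trichotomy a c with h | rfl | h
  · exact ⟨_, inv_ne_zero S.q_ne_zero, S.T_T_row h hc⟩
  · exact ⟨1, one_ne_zero, QComm.one_iff.2 rfl⟩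
  · exact ⟨_, inv_ne_zero (inv_ne_zero S.q_ne_zero),
      (S.T_T_row h ha).symm (inv_ne_zero S.q_ne_zero)⟩

/-- Moving a generator past a segment from left to right. -/
lemma exists_F_T {a b c : ℤ} (hab : a ≤ b) (hcb : c < b) :
    ∃ κ μ : k, S.F c * S.T a b =
      κ • (S.T a b * S.F c) + μ • (if c + 1 = a then S.T c b else 0) := by
  rcases lt_trichotomy (c + 1) a with h | h | h
  · exact ⟨1, 0, by rw [S.F_T_far_left hab (by omega)]; simp⟩
  · subst h
    refine ⟨S.q, 1, ?_⟩
    rw [S.T_left hcb]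
    simp
  · rcases (show c = a ∨ a < c by omega) with rfl | h'
    · exact ⟨S.q⁻¹, 0, by rw [S.F_T_first hcb]; simp⟩
    · exact ⟨1, 0, by rw [S.F_T_middle h' hcb]; simp⟩

/-- Moving a generator past a segment from right to left. -/
lemma exists_T_F {a b c : ℤ} (hab : a ≤ b) (hac : a < c) :
    ∃ κ μ : k, S.T a b * S.F c =
      κ • (S.F c * S.T a b) + μ • (if c = b + 1 then S.T a c else 0) := by
  rcases lt_trichotomy c (b + 1) with h | h | h
  · rcases (show c = b ∨ c < b by omega) with rfl | h'
    · exact ⟨S.q⁻¹, 0, by rw [(S.F_T_last hac).symm S.q_ne_zero]; simp⟩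
    · exact ⟨1, 0, by rw [(S.F_T_middle hac h').symm_one]; simp⟩
  · subst h
    refine ⟨S.q, 1, ?_⟩
    rw [S.T_succ hab]
    simp
  · exact ⟨1, 0, by rw [(S.F_T_far_right hab (by omega)).symm_one]; simp⟩

variable {V : Type*} [AddCommGroup V] [Module k V] [Module A V] [IsScalarTower k A V]

lemma exists_T_smul_phi {phi : V} (F_smul_phi : ∀ a, S.F a • phi = S.F (-1 - a) • phi)
    {b c : ℤ} (hb : 0 ≤ b) (hc : -1 - b ≤ c) (hcb : c < b) :
    ∃ κ : k, S.T (-1 - b) c • phi = κ • S.T (-1 - c) b • phi := by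
  induction b, hb using Int.leInduction generalizing c with
  | base =>
    obtain rfl : c = -1 := by omega
    exact ⟨1, by simpa [S.T_self] using F_smul_phi (-1)⟩
  | succ b hb ihb =>
    induction c, hc using Int.leInduction with
    | base =>
      refine ⟨1, ?_⟩
      rw [show -1 - (-1 - (b + 1)) = b + 1 by ring, S.T_self, S.T_self, F_smul_phi]
      simp
    | succ c hc ihc =>
      obtain ⟨κ, ihc⟩ := ihc (by omega)
      rcases (show c + 1 < b ∨ c + 1 = b by omega) with h | h
      · obtain ⟨κ, ih⟩ := ihb (c := c + 1) (by omega) h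
        refine ⟨κ, ?_⟩
        have hF : S.F (-1 - (b + 1)) • phi = S.F (b + 1) • phi := by
          rw [F_smul_phi]; congr 2; ring
        have c1 := S.F_T_far_left (a := -1 - (c + 1)) (b := b) (c := -1 - (b + 1)) (by omega)
          (by omega)
        have c2 := S.F_T_far_right (a := -1 - b) (b := c + 1) (c := b + 1) (by omega) (by omega)
        rw [QComm.one_iff] at c1 c2
        rw [S.T_left (by omega : -1 - (b + 1) < c + 1), show -1 - (b + 1) + 1 = -1 - b by ring,
          S.T_succ (by omega : -1 - (c + 1) ≤ b), sub_smul, sub_smul, mul_smul, smul_assoc,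
          mul_smul, hF, ← mul_smul (S.T (-1 - b) (c + 1)), ← c2, mul_smul, ih, smul_comm _ κ,
          ← mul_smul, c1, mul_smul, hF, smul_assoc, mul_smul, mul_smul, smul_comm _ κ,
          smul_sub, smul_comm κ S.q]
      · subst h
        have hc1 : S.T (-1 - (c + 1 + 1)) (c + 1) = _ := S.T_succ hc
        have c3 : S.F (-1 - (c + 1)) * S.T (-1 - c) (c + 1 + 1) =
            S.T (-1 - (c + 1)) (c + 1 + 1) +
              S.q • (S.T (-1 - c) (c + 1 + 1) * S.F (-1 - (c + 1))) := by
          have := S.T_left (a := -1 - (c + 1)) (b := c + 1 + 1) (by omega)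
          rw [show -1 - (c + 1) + 1 = -1 - c by ring] at this
          exact (eq_sub_iff_add_eq.1 this).symm
        rcases (show 0 < c + 1 ∨ c = -1 by omega) with h | h
        · refine ⟨κ, ?_⟩
          have c1 := (S.F_T_middle (a := -1 - (c + 1 + 1)) (b := c) (c := -1 - (c + 1))
            (by omega) (by omega)).symm_one
          have c2 := S.F_T_middle (a := -1 - c) (b := c + 1 + 1) (c := c + 1)
            (by omega) (by omega)
          rw [QComm.one_iff] at c1 c2
          rw [hc1, sub_smul, mul_smul, F_smul_phi, ← mul_smul, c1, smul_assoc, mul_smul, mul_smul,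
            ihc, smul_comm (S.F (-1 - (c + 1))) κ, smul_comm (S.F (c + 1)) κ,
            ← mul_smul (S.F (-1 - (c + 1))), ← mul_smul (S.F (c + 1)), c3, c2, add_smul,
            smul_assoc, mul_smul, mul_smul, F_smul_phi (c + 1), smul_add, smul_comm κ S.q,
            add_sub_cancel_right]
        · subst h
          refine ⟨κ * S.q⁻¹, ?_⟩
          have c1 := (S.F_T_last (a := -2) (b := -1) (by omega)).symm S.q_ne_zero
          have c2 := S.F_T_first (a := 0) (b := 1) (by omega)
          rw [QComm] at c1 c2
          norm_num at hc1 c3 ihc ⊢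
          have hF : S.F 0 • phi = S.F (-1) • phi := by simpa using F_smul_phi 0
          rw [hc1, sub_smul, mul_smul, hF, ← mul_smul, c1, smul_assoc, smul_assoc, mul_smul,
            mul_smul, ihc, smul_comm (S.F (-1)) κ, smul_comm (S.F 0) κ,
            ← mul_smul (S.F (-1)) (S.T 0 1), ← mul_smul (S.F 0) (S.T 0 1), c3, c2, add_smul,
            smul_assoc, mul_smul, smul_assoc, mul_smul, hF]
          generalize S.T 0 1 • S.F (-1) • phi = x
          generalize S.T (-1) 1 • phi = y
          have := S.q_ne_zero
          match_scalars <;> field_simp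
          ring

/-! ### Subalgebras of an interval and the bar involution on segments -/

/-- The subalgebra generated by the `F c` with `lo ≤ c < hi`. -/
def sub (lo hi : ℤ) : Subalgebra k A := Algebra.adjoin k (S.F '' Set.Ico lo hi)

variable {S}

lemma F_mem_sub {lo hi c : ℤ} (h : lo ≤ c) (h' : c < hi) : S.F c ∈ S.sub lo hi :=
  Algebra.subset_adjoin ⟨c, ⟨h, h'⟩, rfl⟩

lemma sub_mono {lo hi lo' hi' : ℤ} (h : lo' ≤ lo) (h' : hi ≤ hi') :
    S.sub lo hi ≤ S.sub lo' hi' :=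
  Algebra.adjoin_mono (Set.image_mono (Set.Ico_subset_Ico h h'))

lemma T_mem_sub {a b hi : ℤ} (hab : a ≤ b) (hb : b < hi) : S.T a b ∈ S.sub a hi := by
  induction b, hab using Int.leInduction with
  | base => rw [T_self]; exact F_mem_sub le_rfl hb
  | succ b h ih =>
    have h1 := ih (by omega)
    have h2 := F_mem_sub (S := S) (by omega : a ≤ b + 1) hb
    rw [T_succ _ h]
    exact sub_mem (mul_mem h1 h2) (Subalgebra.smul_mem _ (mul_mem h2 h1) _)

/-- Stability under left or right multiplication is checked on the generators of `S.sub lo hi`. -/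
lemma sub_induction {M : Type*} [AddCommGroup M] [Module k M] (f : A →ₗ[k] M →ₗ[k] M)
    (hf1 : ∀ v, f 1 v = v) {P : Submodule k M} {lo hi : ℤ}
    (hfmul : (∀ x y v, f (x * y) v = f x (f y v)) ∨ (∀ x y v, f (x * y) v = f y (f x v)))
    (h : ∀ c, lo ≤ c → c < hi → ∀ v ∈ P, f (S.F c) v ∈ P) {u : A} (hu : u ∈ S.sub lo hi)
    {v : M} (hv : v ∈ P) : f u v ∈ P := by
  induction hu using Algebra.adjoin_induction generalizing v with
  | mem x hx => obtain ⟨c, ⟨h1, h2⟩, rfl⟩ := hx; exact h c h1 h2 v hv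
  | algebraMap r =>
    rw [Algebra.algebraMap_eq_smul_one, map_smul, LinearMap.smul_apply, hf1]
    exact P.smul_mem _ hv
  | add x y _ _ hx hy => rw [map_add, LinearMap.add_apply]; exact P.add_mem (hx hv) (hy hv)
  | mul x y _ _ hx hy =>
    rcases hfmul with hf | hf
    · rw [hf]; exact hx (hy hv)
    · rw [hf]; exact hy (hx hv)

lemma sub_mul_mem {P : Submodule k A} {lo hi : ℤ}
    (h : ∀ c, lo ≤ c → c < hi → ∀ v ∈ P, S.F c * v ∈ P) {u : A} (hu : u ∈ S.sub lo hi)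
    {v : A} (hv : v ∈ P) : u * v ∈ P :=
  sub_induction (LinearMap.mul k A) (by simp) (Or.inl (by simp [mul_assoc])) h hu hv

lemma mul_sub_mem {P : Submodule k A} {lo hi : ℤ}
    (h : ∀ c, lo ≤ c → c < hi → ∀ v ∈ P, v * S.F c ∈ P) {u : A} (hu : u ∈ S.sub lo hi)
    {v : A} (hv : v ∈ P) : v * u ∈ P :=
  sub_induction (LinearMap.mul k A).flip (by simp) (Or.inr (by simp [mul_assoc])) h hu hv

lemma span_mul_mem {P : Submodule k A} {s : Set A} {a : A} (h : ∀ x ∈ s, a * x ∈ P) {x : A}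
    (hx : x ∈ Submodule.span k s) : a * x ∈ P :=
  (Submodule.span_le (p := P.comap (LinearMap.mulLeft k a))).2 h hx

lemma mul_span_mem {P : Submodule k A} {s : Set A} {a : A} (h : ∀ x ∈ s, x * a ∈ P) {x : A}
    (hx : x ∈ Submodule.span k s) : x * a ∈ P :=
  (Submodule.span_le (p := P.comap (LinearMap.mulRight k a))).2 h hx

variable (S) in
/-- The span of the products `⟨l, b⟩ v` with `lo ≤ l ≤ b` and `v ∈ S.sub lo b`. -/
def rowSpan (lo b : ℤ) : Submodule k A :=
  Submodule.span k {x | ∃ l v, lo ≤ l ∧ l ≤ b ∧ v ∈ S.sub lo b ∧ x = S.T l b * v}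

lemma sub_mul_rowSpan_mem {lo b : ℤ} {x u : A} (hu : u ∈ S.sub lo b) (hx : x ∈ S.rowSpan lo b) :
    u * x ∈ S.rowSpan lo b := by
  refine sub_mul_mem (fun c hc hcb v hv => ?_) hu hx
  refine span_mul_mem ?_ hv
  rintro _ ⟨l, v, hl, hb, hv, rfl⟩
  obtain ⟨κ, μ, h⟩ := S.exists_F_T hb hcb
  rw [← mul_assoc, h, add_mul, smul_mul_assoc, smul_mul_assoc, mul_assoc]
  refine add_mem (Submodule.smul_mem _ _ (Submodule.subset_span
    ⟨l, _, hl, hb, mul_mem (F_mem_sub hc hcb) hv, rfl⟩)) (Submodule.smul_mem _ _ ?_)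
  split_ifs
  · exact Submodule.subset_span ⟨c, v, hc, hcb.le, hv, rfl⟩
  · simp

lemma T_mem_rowSpan {lo b l : ℤ} (hl : lo ≤ l) (hb : l ≤ b) : S.T l b ∈ S.rowSpan lo b :=
  Submodule.subset_span ⟨l, 1, hl, hb, one_mem _, (mul_one _).symm⟩

lemma F_mul_sub_mem {a b : ℤ} (hab : a < b) {u : A} (hu : u ∈ S.sub (a + 1) b) :
    S.F a * u ∈ Submodule.span k
      {x | ∃ i v, a ≤ i ∧ i < b ∧ v ∈ S.sub (a + 1) b ∧ x = v * S.T a i} := by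
  refine mul_sub_mem (fun c hc hcb v hv => ?_) hu
    (Submodule.subset_span ⟨a, 1, le_rfl, hab, one_mem _, by rw [T_self, one_mul]⟩)
  refine mul_span_mem ?_ hv
  rintro _ ⟨i, v, hi, hb, hv, rfl⟩
  obtain ⟨κ, μ, h⟩ := S.exists_T_F hi (by omega : a < c)
  rw [mul_assoc, h, mul_add, mul_smul_comm, mul_smul_comm, ← mul_assoc]
  refine add_mem (Submodule.smul_mem _ _ (Submodule.subset_span
    ⟨i, _, hi, hb, mul_mem hv (F_mem_sub hc hcb), rfl⟩)) (Submodule.smul_mem _ _ ?_)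
  split_ifs
  · exact Submodule.subset_span ⟨c, v, by omega, hcb, hv, rfl⟩
  · simp

variable (S) in
/-- The span of the products `⟨l, b⟩ u F_a v` with `a < l ≤ b` and `u, v` not involving `F_a`. -/
def barSpan (a b : ℤ) : Submodule k A :=
  Submodule.span k {x | ∃ l u v, a < l ∧ l ≤ b ∧ u ∈ S.sub (a + 1) b ∧ v ∈ S.sub (a + 1) b ∧
    x = S.T l b * (u * S.F a * v)}

variable (S) in
/-- A ring endomorphism inverting `q` and fixing the generators. -/
structure IsBar (bar : A →+* A) : Prop where
  map_q_smul : ∀ x, bar (S.q • x) = S.q⁻¹ • bar x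
  map_F : ∀ a, bar (S.F a) = S.F a

section Bar

variable {bar : A →+* A} (hbar : S.IsBar bar)

include hbar

lemma bar_T_mem_sub {a b hi : ℤ} (hab : a ≤ b) (hb : b < hi) : bar (S.T a b) ∈ S.sub a hi := by
  induction b, hab using Int.leInduction with
  | base => rw [T_self, hbar.map_F]; exact F_mem_sub le_rfl hb
  | succ b h ih =>
    have h1 := ih (by omega)
    have h2 := F_mem_sub (S := S) (by omega : a ≤ b + 1) hb
    rw [T_succ _ h, map_sub, hbar.map_q_smul, map_mul, map_mul, hbar.map_F]
    exact sub_mem (mul_mem h1 h2) (Subalgebra.smul_mem _ (mul_mem h2 h1) _)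

lemma bar_T_sub_mem {a b : ℤ} (hab : a ≤ b) : bar (S.T a b) - S.T a b ∈ S.barSpan a b := by
  induction a, hab using Int.leInductionDown with
  | base => simp [T_self, hbar.map_F]
  | pred a hab ih =>
    have hle : S.sub (a + 1) b ≤ S.sub a b := sub_mono (by omega) le_rfl
    have key : ∀ u ∈ S.sub (a + 1) b, ∀ v ∈ S.sub (a + 1) b, u * S.F a * v ∈ S.sub a b ∨ a = b := by
      intro u hu v hv
      rcases hab.eq_or_lt with h | h
      · exact Or.inr h
      · exact Or.inl (mul_mem (mul_mem (hle hu) (F_mem_sub le_rfl h)) (hle hv))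
    have h1 : S.F (a - 1) * (bar (S.T a b) - S.T a b) ∈ S.barSpan (a - 1) b := by
      refine span_mul_mem ?_ ih
      rintro _ ⟨l, u, v, hl, hb, hu, hv, rfl⟩
      have hc := S.F_T_far_left (a := l) (b := b) (c := a - 1) hb (by omega)
      rw [QComm.one_iff] at hc
      rw [← mul_assoc, hc, mul_assoc]
      exact Submodule.subset_span ⟨l, 1, u * S.F a * v, by omega, hb, one_mem _,
        by rw [sub_add_cancel]; exact (key u hu v hv).resolve_right (by omega), by rw [one_mul]⟩
    have h2 : (bar (S.T a b) - S.T a b) * S.F (a - 1) ∈ S.barSpan (a - 1) b := by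
      refine mul_span_mem ?_ ih
      rintro _ ⟨l, u, v, hl, hb, hu, hv, rfl⟩
      exact Submodule.subset_span ⟨l, u * S.F a * v, 1, by omega, hb,
        by rw [sub_add_cancel]; exact (key u hu v hv).resolve_right (by omega), one_mem _,
        by rw [mul_one, mul_assoc]⟩
    have h3 : S.T a b * S.F (a - 1) ∈ S.barSpan (a - 1) b :=
      Submodule.subset_span ⟨a, 1, 1, by omega, hab, one_mem _, one_mem _, by simp⟩
    have h4 : bar (S.T (a - 1) b) - S.T (a - 1) b = S.F (a - 1) * (bar (S.T a b) - S.T a b)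
        - S.q⁻¹ • ((bar (S.T a b) - S.T a b) * S.F (a - 1))
        + (S.q - S.q⁻¹) • (S.T a b * S.F (a - 1)) := by
      rw [S.T_left (by omega : a - 1 < b), sub_add_cancel, map_sub, hbar.map_q_smul, map_mul,
        map_mul, hbar.map_F]
      simp only [mul_sub, sub_mul]
      module
    rw [h4]
    exact add_mem (sub_mem h1 (Submodule.smul_mem _ _ h2)) (Submodule.smul_mem _ _ h3)

lemma T_bar_T {a b : ℤ} (hab : a ≤ b) : QComm (1 : k) (S.T a b) (bar (S.T a b)) := by
  rcases hab.eq_or_lt with rfl | hab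
  · rw [T_self, hbar.map_F]; exact QComm.one_iff.2 rfl
  have key : ∀ c, a ≤ c → c < b → QComm S.q (S.T a b) (bar (S.T a c)) := by
    intro c hc hcb
    induction c, hc using Int.leInduction with
    | base =>
      rw [T_self, hbar.map_F]
      simpa using (S.F_T_first hab).symm (inv_ne_zero S.q_ne_zero)
    | succ c hc ih =>
      have h := (S.F_T_middle (a := a) (b := b) (c := c + 1) (by omega) hcb).symm_one
      rw [T_succ _ hc, map_sub, hbar.map_q_smul, map_mul, map_mul, hbar.map_F]
      simpa using (ih (by omega)).qbracket h S.q⁻¹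
  have h := (key (b - 1) (by omega) (by omega)).qbracket
    ((S.F_T_last hab).symm S.q_ne_zero) S.q⁻¹
  rw [mul_inv_cancel₀ S.q_ne_zero] at h
  have h2 := S.T_succ (by omega : a ≤ b - 1)
  rw [sub_add_cancel] at h2
  nth_rewrite 2 [h2]
  rwa [map_sub, hbar.map_q_smul, map_mul, map_mul, hbar.map_F]

end Bar

/-! ### Row monomials -/

variable (S) in
/-- The monomial `⟨b, b⟩^{ν b} ⟨b-1, b⟩^{ν (b-1)} ⋯` with `n` factors. -/
def row (b : ℤ) (ν : ℤ → ℕ) : ℕ → A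
  | 0 => 1
  | n + 1 => row b ν n * S.T (b - n) b ^ ν (b - n)

lemma row_congr {b : ℤ} {ν ν' : ℤ → ℕ} {n : ℕ} (h : ∀ d, b - n < d → d ≤ b → ν d = ν' d) :
    S.row b ν n = S.row b ν' n := by
  induction n with
  | zero => rfl
  | succ n ih =>
    push_cast at h
    rw [row, row, ih fun d hd => h d (by omega), h _ (by omega) (by omega)]

lemma row_zero {b : ℤ} {n : ℕ} : S.row b 0 n = 1 := by
  induction n with
  | zero => rfl
  | succ n ih => simp [row, ih]

lemma row_mul_pow {b : ℤ} {ν : ℤ → ℕ} {n : ℕ} {c : ℤ} (hc : c = b - n) (e : ℕ) :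
    S.row b ν n * S.T c b ^ e = S.row b (Function.update ν c e) (n + 1) := by
  subst hc
  rw [row, Function.update_self]
  congr 1
  exact row_congr fun d hd _ => (Function.update_of_ne (by omega) _ _).symm

lemma exists_qcomm_pow {κ : k} {x y : A} (hκ : κ ≠ 0) (h : QComm κ x y) (n : ℕ) :
    ∃ μ : k, μ ≠ 0 ∧ QComm μ x (y ^ n) := by
  induction n with
  | zero => exact ⟨1, one_ne_zero, by simp [QComm]⟩
  | succ n ih =>
    obtain ⟨μ, hμ, ih⟩ := ih
    exact ⟨μ * κ, mul_ne_zero hμ hκ, by rw [pow_succ]; exact ih.mul_right h⟩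

lemma exists_qcomm_row {b l : ℤ} (hl : l ≤ b) (ν : ℤ → ℕ) (n : ℕ) :
    ∃ κ : k, κ ≠ 0 ∧ QComm κ (S.T l b) (S.row b ν n) := by
  induction n with
  | zero => exact ⟨1, one_ne_zero, by simp [QComm, row]⟩
  | succ n ih =>
    obtain ⟨κ, hκ, h⟩ := ih
    obtain ⟨μ, hμ, h'⟩ := S.exists_T_T_row hl (by omega : b - (n : ℤ) ≤ b)
    obtain ⟨μ', hμ', h'⟩ := exists_qcomm_pow hμ h' (ν (b - n))
    exact ⟨κ * μ', mul_ne_zero hκ hμ', h.mul_right h'⟩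

lemma exists_row_mul_T {b l : ℤ} {n : ℕ} (hn : b - n < l) (hl : l ≤ b) (ν : ℤ → ℕ) :
    ∃ κ : k, κ ≠ 0 ∧ S.row b ν n * S.T l b = κ • S.row b (ν + Pi.single l 1) n := by
  induction n with
  | zero => simp at hn; omega
  | succ n ih =>
    push_cast at hn
    rcases (show l = b - n ∨ b - n < l by omega) with rfl | h
    · refine ⟨1, one_ne_zero, ?_⟩
      rw [row, row, one_smul, mul_assoc, ← pow_succ]
      simp only [Pi.add_apply, Pi.single_eq_same]
      congr 1
      refine row_congr fun d hd _ => ?_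
      simp [Pi.single_eq_of_ne (show d ≠ b - n by omega)]
    · obtain ⟨κ, hκ, ih⟩ := ih h
      obtain ⟨μ, hμ, h'⟩ := S.exists_T_T_row hl (by omega : b - (n : ℤ) ≤ b)
      obtain ⟨μ', hμ', h'⟩ := exists_qcomm_pow hμ h' (ν (b - n))
      have h' := h'.symm hμ'
      refine ⟨μ'⁻¹ * κ, mul_ne_zero (inv_ne_zero hμ') hκ, ?_⟩
      rw [row, row, mul_assoc, h', mul_smul_comm, ← mul_assoc, ih, smul_mul_assoc, smul_smul]
      simp [Pi.single_eq_of_ne (show b - n ≠ l by omega)]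

lemma exists_T_mul_row {b l : ℤ} {n : ℕ} (hn : b - n < l) (hl : l ≤ b) (ν : ℤ → ℕ) :
    ∃ κ : k, κ ≠ 0 ∧ S.T l b * S.row b ν n = κ • S.row b (ν + Pi.single l 1) n := by
  obtain ⟨κ, hκ, h⟩ := exists_row_mul_T (S := S) hn hl ν
  obtain ⟨μ, hμ, h'⟩ := exists_qcomm_row (S := S) hl ν n
  exact ⟨μ * κ, mul_ne_zero hμ hκ, by rw [h', h, smul_smul]⟩

/-- Comparison of the restrictions of two exponent functions to `[lo, hi]`, read from `lo` on. -/
def RowLt (lo hi : ℤ) (ν' ν : ℤ → ℕ) : Prop :=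
  ∃ c, lo ≤ c ∧ c ≤ hi ∧ ν' c < ν c ∧ ∀ d, lo ≤ d → d < c → ν' d = ν d

lemma RowLt.add_single {lo hi c c' : ℤ} {ν' ν : ℤ → ℕ} (h : RowLt lo hi ν' ν) (hc : lo ≤ c)
    (hcc' : c ≤ c') : RowLt lo hi (ν' + Pi.single c' 1) (ν + Pi.single c 1) := by
  obtain ⟨d, h1, h2, h3, h4⟩ := h
  rcases lt_or_ge c d with h | h
  · rcases hcc'.eq_or_lt with rfl | hcc'
    · refine ⟨d, h1, h2, by simpa using h3, fun e he hed => ?_⟩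
      simp [h4 e he hed]
    · refine ⟨c, hc, by omega, ?_, fun e he hec => ?_⟩
      · simp [Pi.single_eq_of_ne hcc'.ne, h4 c hc h]
      · simp [Pi.single_eq_of_ne hec.ne, Pi.single_eq_of_ne (hec.trans hcc').ne,
          h4 e he (hec.trans h)]
  · refine ⟨d, h1, h2, ?_, fun e he hed => ?_⟩
    · by_cases hd : d = c'
      · obtain rfl : d = c := by omega
        subst hd
        simpa using h3
      · simp only [Pi.add_apply, Pi.single_eq_of_ne hd]
        omega
    · simp [Pi.single_eq_of_ne (show e ≠ c by omega), Pi.single_eq_of_ne (show e ≠ c' by omega),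
        h4 e he hed]

lemma RowLt.of_add_single {lo hi c c' : ℤ} (ν : ℤ → ℕ) (hc : lo ≤ c) (hcc' : c < c')
    (hc' : c' ≤ hi) : RowLt lo hi (ν + Pi.single c' 1) (ν + Pi.single c 1) := by
  refine ⟨c, hc, by omega, ?_, fun e he hec => ?_⟩
  · simp [Pi.single_eq_of_ne hcc'.ne]
  · simp [Pi.single_eq_of_ne hec.ne, Pi.single_eq_of_ne (hec.trans hcc').ne]

variable (S) in
/-- The span of the products of a smaller row monomial with an element of a smaller subalgebra. -/
def lowerSpan (b : ℤ) (ν : ℤ → ℕ) (n : ℕ) : Submodule k A :=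
  Submodule.span k {x | ∃ ν' u, RowLt (b - n + 1) b ν' ν ∧ u ∈ S.sub (b - n + 1) b ∧
    x = S.row b ν' n * u}

lemma lowerSpan_mul_mem {b c : ℤ} {ν : ℤ → ℕ} {n : ℕ} (hc : c = b - n + 1) {x y : A}
    (hx : x ∈ S.lowerSpan b ν n) (hy : y ∈ S.rowSpan c b) :
    x * y ∈ S.lowerSpan b (ν + Pi.single c 1) n := by
  subst hc
  refine mul_span_mem ?_ hx
  rintro _ ⟨ν', u, hν, hu, rfl⟩
  rw [mul_assoc]
  refine span_mul_mem ?_ (sub_mul_rowSpan_mem hu hy)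
  rintro _ ⟨l, v, hl, hb, hv, rfl⟩
  obtain ⟨κ, -, h⟩ := exists_row_mul_T (S := S) (by omega : b - n < l) hb ν'
  rw [← mul_assoc, h, smul_mul_assoc]
  exact Submodule.smul_mem _ _ (Submodule.subset_span ⟨_, v, hν.add_single le_rfl hl, hv, rfl⟩)

lemma barSpan_le_rowSpan {a b : ℤ} : S.barSpan a b ≤ S.rowSpan a b := by
  refine Submodule.span_mono ?_
  rintro _ ⟨l, u, v, hl, hb, hu, hv, rfl⟩
  have hle : S.sub (a + 1) b ≤ S.sub a b := sub_mono (by omega) le_rfl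
  exact ⟨l, u * S.F a * v, hl.le, hb,
    mul_mem (mul_mem (hle hu) (F_mem_sub le_rfl (by omega))) (hle hv), rfl⟩

lemma row_mul_barSpan_mem {b c : ℤ} {ν : ℤ → ℕ} {n : ℕ} (hc : c = b - n + 1) {y : A}
    (hy : y ∈ S.barSpan c b) : S.row b ν n * y ∈ S.lowerSpan b (ν + Pi.single c 1) n := by
  subst hc
  refine span_mul_mem ?_ hy
  rintro _ ⟨l, u, v, hl, hb, hu, hv, rfl⟩
  obtain ⟨κ, -, h⟩ := exists_row_mul_T (S := S) (by omega : b - n < l) hb ν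
  rw [← mul_assoc, h, smul_mul_assoc]
  have hle : S.sub (b - n + 1 + 1) b ≤ S.sub (b - n + 1) b := sub_mono (by omega) le_rfl
  exact Submodule.smul_mem _ _ (Submodule.subset_span ⟨_, _, RowLt.of_add_single ν le_rfl hl hb,
    mul_mem (mul_mem (hle hu) (F_mem_sub le_rfl (by omega))) (hle hv), rfl⟩)

section Bar

variable {bar : A →+* A} (hbar : S.IsBar bar)

include hbar

lemma bar_row_sub_mem (b : ℤ) (ν : ℤ → ℕ) (n : ℕ) :
    bar (S.row b ν n) - S.row b ν n ∈ S.lowerSpan b ν n := by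
  induction n with
  | zero => simp [row]
  | succ n ih =>
    have hlo : b - n = b - ((n + 1 : ℕ) : ℤ) + 1 := by push_cast; ring
    suffices h : ∀ e, bar (S.row b ν n * S.T (b - n) b ^ e) - S.row b ν n * S.T (b - n) b ^ e ∈
        S.lowerSpan b (Function.update ν (b - n) e) (n + 1) by
      simpa [row] using h (ν (b - n))
    intro e
    induction e with
    | zero =>
      simp only [pow_zero, mul_one]
      refine Submodule.span_mono ?_ ih
      rintro _ ⟨ν', u, ⟨c, hc1, hc2, hc3, hc4⟩, hu, rfl⟩
      refine ⟨Function.update ν' (b - n) 0, u, ⟨c, by omega, hc2, ?_, fun d hd hdc => ?_⟩,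
        sub_mono (by omega) le_rfl hu, ?_⟩
      · simpa [Function.update_of_ne (show c ≠ b - n by omega)] using hc3
      · rcases eq_or_ne d (b - n) with rfl | hd'
        · simp
        · simpa [Function.update_of_ne hd'] using hc4 d (by omega) hdc
      · rw [← row_mul_pow rfl, pow_zero, mul_one]
    | succ e ih =>
      have hup : Function.update ν (b - n) (e + 1) =
          Function.update ν (b - n) e + Pi.single (b - n) 1 := by
        ext d
        rcases eq_or_ne d (b - n) with rfl | hd'
        · simp
        · simp [Function.update_of_ne hd', Pi.single_eq_of_ne hd']
      have hy := bar_T_sub_mem hbar (show b - (n : ℤ) ≤ b by omega)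
      have h1 := lowerSpan_mul_mem hlo ih (T_mem_rowSpan (S := S) le_rfl (show b - n ≤ b by omega))
      have h2 := lowerSpan_mul_mem hlo ih (barSpan_le_rowSpan hy)
      have h3 := row_mul_barSpan_mem (ν := Function.update ν (b - n) e) hlo hy
      rw [← row_mul_pow rfl] at h3
      rw [hup]
      convert add_mem (add_mem h1 h2) h3 using 1
      rw [pow_succ, ← mul_assoc, map_mul bar _ (S.T (b - n) b)]
      noncomm_ring

lemma bar_row_mem_sub {b lo hi : ℤ} {n : ℕ} (hlo : lo ≤ b - n + 1) (hhi : b < hi) (ν : ℤ → ℕ) :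
    bar (S.row b ν n) ∈ S.sub lo hi := by
  induction n with
  | zero => simp [row]
  | succ n ih =>
    push_cast at hlo
    rw [row, map_mul, map_pow]
    exact mul_mem (ih (by omega))
      (pow_mem (sub_mono (by omega) le_rfl (bar_T_mem_sub hbar (by omega) hhi)) _)

end Bar

/-! ### The filtration of the module generated by a row -/

variable {V : Type*} [AddCommGroup V] [Module k V] [Module A V] [IsScalarTower k A V]

lemma smul_span_mem {P : Submodule k V} {s : Set V} {a : A} (h : ∀ x ∈ s, a • x ∈ P) {x : V}
    (hx : x ∈ Submodule.span k s) : a • x ∈ P :=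
  (Submodule.span_le (p := P.comap (Algebra.lsmul k k V a))).2 h hx

lemma span_smul_mem {P : Submodule k V} {s : Set A} {v : V} (h : ∀ x ∈ s, x • v ∈ P) {x : A}
    (hx : x ∈ Submodule.span k s) : x • v ∈ P :=
  (Submodule.span_le (p := P.comap ((Algebra.lsmul k k V).toLinearMap.flip v))).2 h hx

lemma sub_smul_mem {P : Submodule k V} {lo hi : ℤ}
    (h : ∀ c, lo ≤ c → c < hi → ∀ v ∈ P, S.F c • v ∈ P) {u : A} (hu : u ∈ S.sub lo hi)
    {v : V} (hv : v ∈ P) : u • v ∈ P :=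
  sub_induction (Algebra.lsmul k k V).toLinearMap (by simp)
    (Or.inl (by simp)) h hu hv

variable (S) in
/-- The span of the `R u φ` with `R` a monomial of the row `b` in which the exponent of
`⟨-1-b, b⟩` is less than `n`, and with `u ∈ S.sub (-b) b`. -/
def rowFilt (phi : V) (b n : ℕ) : Submodule k V :=
  Submodule.span k {x | ∃ ν u, ν (-1 - (b : ℤ)) < n ∧ u ∈ S.sub (-b) b ∧
    x = (S.row b ν (2 * b + 2) * u) • phi}

omit [IsScalarTower k A V] in
lemma rowFilt_mono {phi : V} {b n n' : ℕ} (h : n ≤ n') :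
    S.rowFilt phi b n ≤ S.rowFilt phi b n' := by
  refine Submodule.span_mono ?_
  rintro _ ⟨ν, u, hν, hu, rfl⟩
  exact ⟨ν, u, by omega, hu, rfl⟩

lemma T_smul_rowFilt_mem {phi : V} {b n : ℕ} {c : ℤ} (hc : -1 - (b : ℤ) ≤ c) (hcb : c ≤ b)
    {x : V} (hx : x ∈ S.rowFilt phi b n) :
    S.T c b • x ∈ S.rowFilt phi b (n + if c = -1 - b then 1 else 0) := by
  refine smul_span_mem ?_ hx
  rintro _ ⟨ν, u, hν, hu, rfl⟩
  obtain ⟨κ, -, h⟩ := exists_T_mul_row (S := S) (n := 2 * b + 2) (by push_cast; omega) hcb ν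
  rw [← mul_smul, ← mul_assoc, h, smul_mul_assoc, smul_assoc]
  refine Submodule.smul_mem _ _ (Submodule.subset_span ⟨_, u, ?_, hu, rfl⟩)
  split_ifs with hcl
  · simpa [hcl] using hν
  · simpa [Pi.single_eq_of_ne' hcl] using hν

lemma T_smul_rowFilt_mem_of_lt {phi : V} {b n : ℕ} {c : ℤ} (hc : -1 - (b : ℤ) < c) (hcb : c ≤ b)
    {x : V} (hx : x ∈ S.rowFilt phi b n) : S.T c b • x ∈ S.rowFilt phi b n := by
  simpa [hc.ne'] using T_smul_rowFilt_mem hc.le hcb hx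

lemma rowSpan_smul_mem_rowFilt {phi : V} {b : ℕ} {x : A} (hx : x ∈ S.rowSpan (-b) b) :
    x • phi ∈ S.rowFilt phi b 1 := by
  refine span_smul_mem ?_ hx
  rintro _ ⟨l, v, hl, hb, hv, rfl⟩
  rw [mul_smul]
  refine T_smul_rowFilt_mem_of_lt (by omega) hb
    (Submodule.subset_span ⟨0, v, by simp, hv, by rw [row_zero, one_mul]⟩)

section Phi

variable {phi : V} (F_smul_phi : ∀ a, S.F a • phi = S.F (-1 - a) • phi)

include F_smul_phi

lemma F_lo_smul_mem_rowFilt {b : ℕ} {u : A} (hu : u ∈ S.sub (-b) b) :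
    (S.F (-1 - b) * u) • phi ∈ S.rowFilt phi b 1 := by
  have h1 : (-1 - (b : ℤ)) + 1 = -b := by ring
  refine span_smul_mem ?_ (F_mul_sub_mem (by omega : -1 - (b : ℤ) < b) (h1 ▸ hu))
  rintro _ ⟨i, v, hi, hib, hv, rfl⟩
  rw [h1] at hv
  obtain ⟨κ, h⟩ := S.exists_T_smul_phi F_smul_phi (by omega : 0 ≤ (b : ℤ)) hi hib
  rw [mul_smul, h, smul_comm v κ, ← mul_smul]
  exact Submodule.smul_mem _ _ (rowSpan_smul_mem_rowFilt
    (sub_mul_rowSpan_mem hv (T_mem_rowSpan (by omega) (by omega))))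

lemma F_smul_row_mem {b : ℕ} {c : ℤ} (hc : -1 - (b : ℤ) ≤ c) (hcb : c < b) {u : A}
    (hu : u ∈ S.sub (-b) b) (ν : ℤ → ℕ) :
    S.F c • (S.row b ν (2 * b + 2) * u) • phi ∈
      S.rowFilt phi b (ν (-1 - b) + 1 + if c = -1 - b then 1 else 0) := by
  induction hN : ∑ d ∈ Finset.Icc (-1 - (b : ℤ)) b, ν d generalizing ν with
  | zero =>
    have hν : S.row b ν (2 * b + 2) = 1 := by
      rw [← row_zero (S := S) (b := b) (n := 2 * b + 2)]
      refine row_congr fun d hd hdb => ?_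
      push_cast at hd
      exact Finset.sum_eq_zero_iff.1 hN d (Finset.mem_Icc.2 ⟨by omega, hdb⟩)
    rw [hν, one_mul, ← mul_smul]
    split_ifs with h
    · subst h
      exact rowFilt_mono (by omega) (F_lo_smul_mem_rowFilt F_smul_phi hu)
    · exact Submodule.subset_span ⟨0, S.F c * u, by simp,
        mul_mem (F_mem_sub (by omega) hcb) hu, by rw [row_zero, one_mul]⟩
  | succ N ih =>
    obtain ⟨l, hl, hl0⟩ : ∃ l ∈ Finset.Icc (-1 - (b : ℤ)) b, ν l ≠ 0 := by
      by_contra! h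
      rw [Finset.sum_eq_zero h] at hN
      omega
    obtain ⟨ν, rfl⟩ : ∃ ν' : ℤ → ℕ, ν = ν' + (Pi.single l 1 : ℤ → ℕ) := by
      refine ⟨Function.update ν l (ν l - 1), funext fun d => ?_⟩
      rcases eq_or_ne d l with rfl | hd
      · simp only [Pi.add_apply, Function.update_self, Pi.single_eq_same]
        omega
      · simp [Pi.single_eq_of_ne hd, Function.update_of_ne hd]
    simp only [Pi.add_apply, Finset.sum_add_distrib, Finset.sum_pi_single', if_pos hl] at hN
    have ih := ih ν (by omega)
    have hl' := Finset.mem_Icc.1 hl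
    obtain ⟨κ, hκ, h⟩ := exists_T_mul_row (S := S) (n := 2 * b + 2) (by push_cast; omega) hl'.2 ν
    rw [eq_comm, ← eq_inv_smul_iff₀ hκ] at h
    obtain ⟨κ', μ, h'⟩ := S.exists_F_T hl'.2 hcb
    rw [h, smul_mul_assoc, smul_assoc, smul_comm (S.F c) κ⁻¹]
    refine Submodule.smul_mem _ _ ?_
    rw [mul_assoc, mul_smul (S.T l b), ← mul_smul (S.F c), h', add_smul, smul_assoc, smul_assoc,
      mul_smul]
    refine add_mem (Submodule.smul_mem _ _ ?_) (Submodule.smul_mem _ _ ?_)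
    · refine rowFilt_mono (le_of_eq ?_) (T_smul_rowFilt_mem hl'.1 hl'.2 ih)
      by_cases h : l = -1 - (b : ℤ)
      · simp only [h, if_true, Pi.add_apply, Pi.single_eq_same]
        omega
      · simp [h]
    · by_cases h : c + 1 = l
      · rw [if_pos h]
        refine rowFilt_mono ?_ (T_smul_rowFilt_mem hc hcb.le (Submodule.subset_span
          ⟨ν, u, Nat.lt_succ_self _, hu, rfl⟩))
        simp
      · simp [h]

lemma F_smul_rowFilt_mem {b n : ℕ} {c : ℤ} (hc : -1 - (b : ℤ) ≤ c) (hcb : c ≤ b) {x : V}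
    (hx : x ∈ S.rowFilt phi b n) :
    S.F c • x ∈ S.rowFilt phi b (n + if c = -1 - b then 1 else 0) := by
  rcases hcb.eq_or_lt with rfl | hcb
  · rw [← S.T_self]
    exact T_smul_rowFilt_mem hc le_rfl hx
  · refine smul_span_mem ?_ hx
    rintro _ ⟨ν, u, hν, hu, rfl⟩
    exact rowFilt_mono (by omega) (F_smul_row_mem F_smul_phi hc hcb hu ν)

lemma sub_smul_rowFilt_mem {b n : ℕ} {u : A} (hu : u ∈ S.sub (-b) (b + 1)) {x : V}
    (hx : x ∈ S.rowFilt phi b n) : u • x ∈ S.rowFilt phi b n := by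
  refine sub_smul_mem (fun c hc hcb v hv => ?_) hu hx
  simpa [show c ≠ -1 - (b : ℤ) by omega] using
    F_smul_rowFilt_mem F_smul_phi (by omega) (by omega : c ≤ b) hv

lemma barSpan_smul_mem {b n : ℕ} {y : A} (hy : y ∈ S.barSpan (-1 - b) b) {x : V}
    (h : ∀ v ∈ S.sub (-b) b, S.F (-1 - b) • v • x ∈ S.rowFilt phi b n) :
    y • x ∈ S.rowFilt phi b n := by
  have h1 : (-1 - (b : ℤ)) + 1 = -b := by ring
  refine span_smul_mem ?_ hy
  rintro _ ⟨l, u, v, hl, hb, hu, hv, rfl⟩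
  rw [h1] at hu hv
  rw [mul_smul, mul_smul, mul_smul]
  exact T_smul_rowFilt_mem_of_lt hl hb (sub_smul_rowFilt_mem F_smul_phi
    (sub_mono le_rfl (by omega) hu) (h v hv))

section Bar

variable {bar : A →+* A} (hbar : S.IsBar bar)

include hbar

lemma bar_T_smul_rowFilt_mem {b n : ℕ} {x : V} (hx : x ∈ S.rowFilt phi b n) :
    bar (S.T (-1 - b) b) • x ∈ S.rowFilt phi b (n + 1) := by
  have h := barSpan_smul_mem F_smul_phi (bar_T_sub_mem hbar (by omega : -1 - (b : ℤ) ≤ b))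
    (x := x) (n := n + 1) fun v hv => by
      simpa using F_smul_rowFilt_mem F_smul_phi le_rfl (by omega)
        (sub_smul_rowFilt_mem F_smul_phi (sub_mono le_rfl (by omega) hv) hx)
  have h' := T_smul_rowFilt_mem (S := S) le_rfl (by omega : -1 - (b : ℤ) ≤ b) hx
  rw [if_pos rfl] at h'
  simpa [sub_smul] using add_mem h h'

lemma bar_T_pow_sub_smul_mem {b : ℕ} {w : A} (hw : w ∈ S.sub (-b) b) (n : ℕ) :
    (bar (S.T (-1 - b) b) ^ n * w - S.T (-1 - b) b ^ n * w) • phi ∈ S.rowFilt phi b n := by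
  induction n with
  | zero => simp
  | succ n ih =>
    set t := S.T (-1 - (b : ℤ)) b with ht
    have hpow : ∀ {m : ℕ} {x : V} (i : ℕ), x ∈ S.rowFilt phi b m →
        t ^ i • x ∈ S.rowFilt phi b (m + i) := by
      intro m x i hx
      induction i with
      | zero => simpa using hx
      | succ i ih =>
        have h := T_smul_rowFilt_mem (S := S) le_rfl (by omega : -1 - (b : ℤ) ≤ b) ih
        rwa [if_pos rfl, ← mul_smul, ← pow_succ'] at h
    have h1 : (bar t - t) • (w • phi) ∈ S.rowFilt phi b 1 :=
      barSpan_smul_mem F_smul_phi (bar_T_sub_mem hbar (by omega)) fun v hv => by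
        rw [← mul_smul, ← mul_smul]
        simpa [mul_assoc] using F_lo_smul_mem_rowFilt F_smul_phi (mul_mem hv hw)
    have h2 := hpow n h1
    have h3 := bar_T_smul_rowFilt_mem F_smul_phi hbar ih
    have hc : Commute t (bar t) :=
      QComm.one_iff.1 (T_bar_T hbar (by omega : -1 - (b : ℤ) ≤ b))
    have hc' : t ^ n * bar t = bar t * t ^ n := (hc.pow_left n).eq
    rw [add_comm 1 n] at h2
    convert add_mem h3 h2 using 1
    rw [← ht, ← mul_smul, ← mul_smul, ← mul_smul, ← add_smul]
    congr 1
    rw [mul_sub, ← mul_assoc, mul_sub, hc', pow_succ', pow_succ]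
    noncomm_ring

end Bar

/-! ### The PBW monomials -/

variable (S) in
/-- The PBW monomial with the exponents of the row `b` given by `m b`, for the rows `b < B`. -/
def pbw (m : ℕ → ℤ → ℕ) : ℕ → A
  | 0 => 1
  | B + 1 => S.row B (m B) (2 * B + 2) * pbw m B

omit F_smul_phi in
lemma pbw_congr {m m' : ℕ → ℤ → ℕ} {B : ℕ}
    (h : ∀ b < B, ∀ d, -1 - (b : ℤ) ≤ d → d ≤ b → m b d = m' b d) : S.pbw m B = S.pbw m' B := by
  induction B with
  | zero => rfl
  | succ B ih =>
    rw [pbw, pbw, ih fun b hb => h b (by omega)]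
    congr 1
    refine row_congr fun d hd hdB => h B (by omega) d ?_ hdB
    push_cast at hd
    omega

omit F_smul_phi in
lemma pbw_update {m : ℕ → ℤ → ℕ} {B : ℕ} (ν : ℤ → ℕ) :
    S.pbw (Function.update m B ν) (B + 1) = S.row B ν (2 * B + 2) * S.pbw m B := by
  rw [pbw, Function.update_self]
  congr 1
  exact pbw_congr fun b hb _ _ _ => by rw [Function.update_of_ne hb.ne]

/-- Comparison of the exponent families of two PBW monomials, starting from the last row. -/
def PBWLt (B : ℕ) (m' m : ℕ → ℤ → ℕ) : Prop :=
  ∃ b < B, RowLt (-1 - b) b (m' b) (m b) ∧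
    ∀ b', b < b' → b' < B → ∀ d, -1 - (b' : ℤ) ≤ d → d ≤ b' → m' b' d = m b' d

omit F_smul_phi in
lemma bar_pbw_mem_sub {bar : A →+* A} (hbar : S.IsBar bar) (m : ℕ → ℤ → ℕ) (B : ℕ) :
    bar (S.pbw m B) ∈ S.sub (-B) B := by
  induction B with
  | zero => simp [pbw]
  | succ B ih =>
    rw [pbw, map_mul]
    exact mul_mem (bar_row_mem_sub hbar (by push_cast; omega) (by push_cast; omega) _)
      (sub_mono (by push_cast; omega) (by push_cast; omega) ih)

omit F_smul_phi in
/-- If the rows below `B` span, then monomials with a prescribed last row span. -/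
lemma row_mul_smul_mem {B : ℕ} {P : Submodule k V} {u : A} {ν : ℤ → ℕ}
    (hu : u • phi ∈ Submodule.span k (Set.range fun m => S.pbw m B • phi))
    (h : ∀ m, S.pbw (Function.update m B ν) (B + 1) • phi ∈ P) :
    (S.row B ν (2 * B + 2) * u) • phi ∈ P := by
  rw [mul_smul]
  refine smul_span_mem ?_ hu
  rintro _ ⟨m, rfl⟩
  simpa only [pbw_update, mul_smul] using h m

lemma sub_smul_phi_mem (B : ℕ) {u : A} (hu : u ∈ S.sub (-B) B) :
    u • phi ∈ Submodule.span k (Set.range fun m => S.pbw m B • phi) := by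
  induction B generalizing u with
  | zero =>
    have hS : S.sub (-(0 : ℕ)) (0 : ℕ) = ⊥ := by simp [sub]
    rw [hS] at hu
    obtain ⟨c, rfl⟩ := Algebra.mem_bot.1 hu
    rw [algebraMap_smul]
    exact Submodule.smul_mem _ _ (Submodule.subset_span ⟨0, by simp [pbw]⟩)
  | succ B ih =>
    have hdir : Directed (· ≤ ·) (S.rowFilt phi B) :=
      (monotone_nat_of_le_succ fun n => rowFilt_mono n.le_succ).directed_le
    have hmem : u • phi ∈ ⨆ n, S.rowFilt phi B n := by
      refine sub_smul_mem (fun c hc hcb v hv => ?_) hu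
        (Submodule.mem_iSup_of_mem 1 (Submodule.subset_span ⟨0, 1, by simp, one_mem _, by
          simp [row_zero]⟩))
      obtain ⟨n, hn⟩ := (Submodule.mem_iSup_of_directed _ hdir).1 hv
      push_cast at hc hcb
      exact Submodule.mem_iSup_of_mem _
        (F_smul_rowFilt_mem F_smul_phi (by omega) (by omega) hn)
    refine (iSup_le fun n => Submodule.span_le.2 ?_) hmem
    rintro _ ⟨ν, u, -, hu, rfl⟩
    exact row_mul_smul_mem (ih hu) fun m => Submodule.subset_span ⟨_, rfl⟩

omit F_smul_phi in
lemma T_pow_comm_sub {a b : ℤ} {u : A} (hu : u ∈ S.sub (a + 1) b) (n : ℕ) :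
    S.T a b ^ n * u = u * S.T a b ^ n := by
  have h : Commute u (S.T a b) := by
    induction hu using Algebra.adjoin_induction with
    | mem x hx =>
      obtain ⟨c, ⟨h1, h2⟩, rfl⟩ := hx
      exact QComm.one_iff.1 (S.F_T_middle (by omega) h2)
    | algebraMap r => exact Algebra.commute_algebraMap_left r _
    | add x y _ _ hx hy => exact hx.add_left hy
    | mul x y _ _ hx hy => exact hx.mul_left hy
  exact (h.pow_right n).eq.symm

theorem bar_pbw_sub_smul_mem {bar : A →+* A} (hbar : S.IsBar bar) (m : ℕ → ℤ → ℕ) (B : ℕ) :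
    (bar (S.pbw m B) - S.pbw m B) • phi ∈
      Submodule.span k {x | ∃ m', PBWLt B m' m ∧ x = S.pbw m' B • phi} := by
  induction B with
  | zero => simp [pbw]
  | succ B ih =>
    set P := Submodule.span k {x | ∃ m', PBWLt (B + 1) m' m ∧ x = S.pbw m' (B + 1) • phi} with hP
    set w := S.pbw m B with hw
    set t := S.T (-1 - (B : ℤ)) B with ht
    set n := m B (-1 - B) with hn
    set r := S.row B (m B) (2 * B + 1) with hr
    have hidx : -1 - (B : ℤ) = B - (2 * B + 1 : ℕ) := by push_cast; ring
    have hrow : S.row B (m B) (2 * B + 2) = r * t ^ n := by rw [row, ← hidx]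
    have hw' : bar w ∈ S.sub (-B) B := bar_pbw_mem_sub hbar m B
    have hPmem : ∀ {ν u}, RowLt (-1 - B) B ν (m B) → u ∈ S.sub (-B) B →
        (S.row B ν (2 * B + 2) * u) • phi ∈ P := fun {ν u} hν hu =>
      row_mul_smul_mem (sub_smul_phi_mem F_smul_phi B hu) fun m' => Submodule.subset_span
        ⟨_, ⟨B, B.lt_succ_self, by rwa [Function.update_self], fun b' h h' => by omega⟩, rfl⟩
    have hfilt : S.rowFilt phi B n ≤ P := by
      refine Submodule.span_le.2 ?_
      rintro _ ⟨ν, u, hν, hu, rfl⟩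
      exact hPmem ⟨_, le_rfl, by omega, hν, fun d hd hd' => by omega⟩ hu
    have h1 : bar r • (bar t ^ n * bar w - t ^ n * bar w) • phi ∈ P :=
      hfilt (sub_smul_rowFilt_mem F_smul_phi
        (bar_row_mem_sub hbar (by push_cast; omega) (by omega) _)
        (bar_T_pow_sub_smul_mem F_smul_phi hbar hw' n))
    have h2 : ((bar r - r) * (t ^ n * bar w)) • phi ∈ P := by
      rw [mul_smul]
      refine span_smul_mem ?_ (bar_row_sub_mem hbar B (m B) (2 * B + 1))
      rintro _ ⟨ν, u, ⟨c, hc1, hc2, hc3, hc4⟩, hu, rfl⟩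
      have hlo : (B : ℤ) - (2 * B + 1 : ℕ) + 1 = -B := by push_cast; ring
      rw [hlo] at hc1 hc4 hu
      have hut : t ^ n * u = u * t ^ n :=
        T_pow_comm_sub (by rwa [show -1 - (B : ℤ) + 1 = -B by ring]) n
      rw [← mul_smul, mul_assoc, ← mul_assoc u, ← hut, mul_assoc, ← mul_assoc,
        row_mul_pow hidx n]
      refine hPmem ⟨c, by omega, hc2, ?_, fun d hd hdc => ?_⟩ (mul_mem hu hw')
      · rwa [Function.update_of_ne (by omega)]
      · rcases eq_or_ne d (-1 - B) with rfl | hd'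
        · rw [Function.update_self]
        · rw [Function.update_of_ne hd']
          exact hc4 d (by omega) hdc
    have h3 : (r * t ^ n) • (bar w - w) • phi ∈ P := by
      refine smul_span_mem ?_ ih
      rintro _ ⟨m', ⟨b, hb, hlt, hagree⟩, rfl⟩
      rw [← hrow, ← mul_smul, ← pbw_update]
      refine Submodule.subset_span ⟨_, ⟨b, by omega, by rwa [Function.update_of_ne hb.ne], ?_⟩, rfl⟩
      intro b' hb' hB d hd hd'
      rcases eq_or_ne b' B with rfl | h
      · rw [Function.update_self]
      · rw [Function.update_of_ne h]
        exact hagree b' hb' (by omega) d hd hd'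
    convert add_mem (add_mem h1 h2) h3 using 1
    rw [← mul_smul, ← mul_smul, ← add_smul, ← add_smul, pbw, hrow]
    congr 1
    simp only [map_mul, map_pow]
    noncomm_ring

end Phi

end SerreFamily

end Abstract

section Scalars

lemma q_ne_zero : q ≠ 0 := RatFunc.X_ne_zero

lemma q_pow_ne_one {n : ℕ} (hn : n ≠ 0) : q ^ n ≠ 1 := by
  intro h
  have h1 : algebraMap (Polynomial ℚ) K (Polynomial.X ^ n) = algebraMap (Polynomial ℚ) K 1 := by
    rw [map_pow, map_one, RatFunc.algebraMap_X]; exact h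
  have h2 := congrArg Polynomial.natDegree (RatFunc.algebraMap_injective ℚ h1)
  simp at h2
  exact hn h2

lemma one_add_q_sq_ne_zero : 1 + q ^ 2 ≠ 0 := by
  intro h
  apply q_pow_ne_one (n := 4) (by norm_num)
  linear_combination (q ^ 2 - 1) * h

lemma q_pow_sub_ne_zero {n : ℕ} (hn : n ≠ 0) : q ^ n - q⁻¹ ^ n ≠ 0 := by
  intro h
  apply q_pow_ne_one (n := n + n) (by omega)
  have h1 : q ^ n * q⁻¹ ^ n = 1 := by rw [← mul_pow, mul_inv_cancel₀ q_ne_zero, one_pow]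
  rw [pow_add]
  linear_combination q ^ n * h + h1

lemma qint_natCast (n : ℕ) : qint n = (q ^ n - q⁻¹ ^ n) * (q - q⁻¹)⁻¹ := by
  simp [qint, div_eq_mul_inv]

variable (bar : U →+* U)

/-- The scalar `κ` is nonzero and invariant under `bar`. -/
def BarFixed (κ : K) : Prop := κ ≠ 0 ∧ bar (algebraMap K U κ) = algebraMap K U κ

variable {bar}

lemma map_inv_of_map {x y : K} (hx : x ≠ 0) (hy : y ≠ 0)
    (h : bar (algebraMap K U x) = algebraMap K U y) :
    bar (algebraMap K U x⁻¹) = algebraMap K U y⁻¹ := by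
  refine left_inv_eq_right_inv (a := algebraMap K U y) ?_ ?_
  · rw [← h, ← map_mul, ← map_mul, inv_mul_cancel₀ hx, map_one, map_one]
  · rw [← map_mul, mul_inv_cancel₀ hy, map_one]

namespace BarFixed

lemma one : BarFixed bar 1 := ⟨one_ne_zero, by simp⟩

lemma mul {x y : K} (hx : BarFixed bar x) (hy : BarFixed bar y) : BarFixed bar (x * y) :=
  ⟨mul_ne_zero hx.1 hy.1, by rw [map_mul, map_mul, hx.2, hy.2]⟩

lemma inv {x : K} (hx : BarFixed bar x) : BarFixed bar x⁻¹ :=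
  ⟨inv_ne_zero hx.1, map_inv_of_map hx.1 hx.1 hx.2⟩

lemma prod {s : Finset ℕ} {f : ℕ → K} (h : ∀ i, BarFixed bar (f i)) :
    BarFixed bar (∏ i ∈ s, f i) :=
  Finset.prod_induction f (BarFixed bar) (fun _ _ => mul) one fun i _ => h i

lemma qint (hbarq : bar (algebraMap K U q) = algebraMap K U q⁻¹) {n : ℕ} (hn : n ≠ 0) :
    BarFixed bar (qint n) := by
  have h1 := q_pow_sub_ne_zero one_ne_zero
  rw [pow_one, pow_one] at h1
  refine ⟨?_, ?_⟩
  · rw [qint_natCast]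
    exact mul_ne_zero (q_pow_sub_ne_zero hn) (inv_ne_zero h1)
  · have hinv := map_inv_of_map q_ne_zero (inv_ne_zero q_ne_zero) hbarq
    rw [inv_inv] at hinv
    have hden : bar (algebraMap K U (q - q⁻¹)) = algebraMap K U (-(q - q⁻¹)) := by
      rw [map_sub, map_sub, hbarq, hinv, neg_sub, map_sub]
    have hden' := map_inv_of_map h1 (neg_ne_zero.2 h1) hden
    have hnum : bar (algebraMap K U (q ^ n - q⁻¹ ^ n)) = algebraMap K U (-(q ^ n - q⁻¹ ^ n)) := by
      rw [map_sub, map_sub, map_pow, map_pow, map_pow, map_pow, hbarq, hinv, neg_sub, map_sub,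
        map_pow, map_pow]
    rw [qint_natCast, map_mul, map_mul, hden', hnum, ← map_mul, ← map_mul, inv_neg, neg_mul_neg]

end BarFixed

end Scalars

section Comparison

/-- The generators of `U_q^-(gl_∞)`, as a family indexed by all the integers. -/
def serreFamily : SerreFamily K U where
  q := q
  F a := fgen (2 * a + 1)
  q_ne_zero := q_ne_zero
  one_add_q_sq_ne_zero := one_add_q_sq_ne_zero
  F_far {a b} h := by
    simp only [fgen, show (2 * a + 1 - 1) / 2 = a by omega, show (2 * b + 1 - 1) / 2 = b by omega,
      ← map_mul]
    exact RingQuot.mkAlgHom_rel K (URel.far a b h)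
  F_serre {a b} h := by
    simp only [fgen, show (2 * a + 1 - 1) / 2 = a by omega, show (2 * b + 1 - 1) / 2 = b by omega,
      ← map_mul, ← map_add, ← map_smul]
    exact RingQuot.mkAlgHom_rel K (URel.serre a b h)

lemma seg_eq_T {a b : ℤ} (h : a ≤ b) : seg (2 * a + 1) (2 * b + 1) = serreFamily.T a b := by
  obtain ⟨n, rfl⟩ := Int.le.dest h
  have h1 : ((2 * (a + n) + 1 - (2 * a + 1)) / 2).toNat = n := by omega
  have h2 : (a + n - a).toNat = n := by omega
  rw [seg, SerreFamily.T, h1, h2]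
  clear h h1 h2
  induction n with
  | zero => rfl
  | succ n ih =>
    rw [segAux, SerreFamily.Taux, ih]
    have h3 : serreFamily.F (a + (n + 1)) = fgen (2 * a + 1 + 2 * (n + 1)) := by
      change fgen _ = _
      congr 1
      ring
    rw [h3]
    rfl

lemma F_smul_phi (a : ℤ) : serreFamily.F a • phi = serreFamily.F (-1 - a) • phi := by
  have h : ∀ x : U, x • phi = (Submodule.Quotient.mk x : Vt) := fun x => by
    rw [phi, ← Submodule.Quotient.mk_smul, smul_eq_mul, mul_one]
  rw [h, h]
  refine (Submodule.Quotient.eq _).2 (Ideal.subset_span ⟨2 * a + 1, ⟨a, rfl⟩, ?_⟩)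
  change fgen _ - fgen _ = _
  congr 2
  ring

lemma isBar {bar : U →+* U} (hbarq : bar (algebraMap K U q) = algebraMap K U q⁻¹)
    (hbarf : ∀ i : ℤ, Odd i → bar (fgen i) = fgen i) : serreFamily.IsBar bar where
  map_q_smul x := by
    rw [Algebra.smul_def, Algebra.smul_def, map_mul]
    exact congrArg (· * bar x) hbarq
  map_F a := hbarf _ ⟨a, rfl⟩

/-- The exponents of a multisegment in terms of half-integral indices. -/
def exponents (m : MS) (b : ℕ) (c : ℤ) : ℕ := (m (2 * c + 1, 2 * b + 1)).toNat

/-- The θ-restricted multisegment with given exponents in the rows `b < B`. -/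
def ofExponents (B : ℕ) (m : ℕ → ℤ → ℕ) : MS :=
  Finsupp.onFinset (Finset.Icc (-(2 * B : ℤ)) (2 * B) ×ˢ Finset.Icc (-(2 * B : ℤ)) (2 * B))
    (fun p => if Odd p.1 ∧ Odd p.2 ∧ -p.2 ≤ p.1 ∧ p.1 ≤ p.2 ∧ p.2 < 2 * B + 1 then
      (m (p.2 / 2).toNat (p.1 / 2) : ℤ) else 0) fun p hp => by
    have h := (ite_ne_right_iff.1 hp).1
    simp only [Finset.mem_product, Finset.mem_Icc]
    omega

lemma ofExponents_apply (B : ℕ) (m : ℕ → ℤ → ℕ) (i j : ℤ) : ofExponents B m (i, j) =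
    if Odd i ∧ Odd j ∧ -j ≤ i ∧ i ≤ j ∧ j < 2 * B + 1 then (m (j / 2).toNat (i / 2) : ℤ) else 0 :=
  rfl

lemma ofExponents_odd {B b : ℕ} {c : ℤ} (m : ℕ → ℤ → ℕ) (hb : b < B) (hc : -1 - (b : ℤ) ≤ c)
    (hcb : c ≤ b) : ofExponents B m (2 * c + 1, 2 * b + 1) = m b c := by
  rw [ofExponents_apply, if_pos ⟨⟨c, rfl⟩, ⟨b, rfl⟩, by omega, by omega, by omega⟩,
    show (2 * (b : ℤ) + 1) / 2 = b by omega, show (2 * c + 1) / 2 = c by omega, Int.toNat_natCast]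

lemma isTheta_ofExponents (B : ℕ) (m : ℕ → ℤ → ℕ) : IsTheta (ofExponents B m) := by
  intro i j h
  have h' := h
  rw [ofExponents_apply] at h'
  obtain ⟨h1, h2, h3, h4, -⟩ := (ite_ne_right_iff.1 h').1
  refine ⟨h1, h2, h3, h4, lt_of_le_of_ne ?_ h.symm⟩
  rw [ofExponents_apply]
  split_ifs
  · exact Int.natCast_nonneg _
  · exact le_rfl

lemma ofExponents_lt_row {B : ℕ} {m : ℕ → ℤ → ℕ} {i j : ℤ} (h : ofExponents B m (i, j) ≠ 0) :
    j < 2 * B + 1 := by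
  rw [ofExponents_apply] at h
  exact (ite_ne_right_iff.1 h).1.2.2.2.2

lemma ofExponents_exponents {m : MS} (hm : IsTheta m) {B : ℕ}
    (hB : ∀ i j, m (i, j) ≠ 0 → j < 2 * B + 1) : ofExponents B (exponents m) = m := by
  ext ⟨i, j⟩
  rw [ofExponents_apply]
  split_ifs with h
  · obtain ⟨⟨c, rfl⟩, ⟨b, rfl⟩, h1, h2, -⟩ := h
    lift b to ℕ using by omega
    rw [show (2 * (b : ℤ) + 1) / 2 = b by omega, show (2 * c + 1) / 2 = c by omega,
      Int.toNat_natCast, exponents, Int.toNat_of_nonneg]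
    by_contra h3
    have := (hm _ _ (by omega : m (2 * c + 1, 2 * b + 1) ≠ 0)).2.2.2.2
    omega
  · by_contra h0
    have h0 := Ne.symm h0
    obtain ⟨h1, h2, h3, h4, -⟩ := hm i j h0
    exact h ⟨h1, h2, h3, h4, hB i j h0⟩

lemma cryLt_ofExponents {B : ℕ} {m' m : ℕ → ℤ → ℕ} (h : SerreFamily.PBWLt B m' m) :
    CryLt (ofExponents B m') (ofExponents B m) := by
  obtain ⟨b, hb, ⟨c, hc1, hc2, hc3, hc4⟩, h⟩ := h
  refine ⟨2 * c + 1, 2 * b + 1, by omega, ?_, fun i hi => ?_, fun i j hj hij => ?_⟩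
  · rw [ofExponents_odd _ hb hc1 hc2, ofExponents_odd _ hb hc1 hc2]
    exact_mod_cast hc3
  · rw [ofExponents_apply, ofExponents_apply]
    split_ifs with h0
    · obtain ⟨⟨d, rfl⟩, -, h1, -⟩ := h0
      rw [show (2 * (b : ℤ) + 1) / 2 = b by omega, show (2 * d + 1) / 2 = d by omega,
        Int.toNat_natCast, hc4 d (by omega) (by omega)]
    · rfl
  · rw [ofExponents_apply, ofExponents_apply]
    split_ifs with h0
    · obtain ⟨⟨d, rfl⟩, ⟨b', rfl⟩, h1, h2, h3⟩ := h0
      rw [show (2 * (b' : ℤ) + 1) / 2 = b' by omega, show (2 * d + 1) / 2 = d by omega,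
        h b'.toNat (by omega) (by omega) d (by omega) (by omega)]
    · rfl

end Comparison

section Products

/-- Products over decreasing lists of integers agree if the extra factors are trivial. -/
lemma prod_map_eq_of_sorted {M : Type*} [Monoid M] {l l' : List ℤ} (hl : l.Pairwise (· > ·))
    (hl' : l'.Pairwise (· > ·)) {f : ℤ → M} (h : ∀ x ∈ l, f x ≠ 1 → x ∈ l')
    (h' : ∀ x ∈ l', f x ≠ 1 → x ∈ l) : (l.map f).prod = (l'.map f).prod := by
  have key : ∀ l : List ℤ, (l.map f).prod = ((l.filter fun x => f x ≠ 1).map f).prod := by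
    intro l
    induction l with
    | nil => rfl
    | cons a l ih =>
      by_cases ha : f a = 1
      · simp [ha, ih]
      · simp [ha, ih]
  rw [key l, key l']
  congr 2
  refine List.Perm.eq_of_pairwise (le := (· > ·)) (fun a b _ _ h1 h2 => absurd h1 h2.asymm)
    (hl.filter _) (hl'.filter _) ?_
  refine (List.perm_ext_iff_of_nodup ((hl.filter _).imp fun h => h.ne')
    ((hl'.filter _).imp fun h => h.ne')).2 fun x => ?_
  simp only [List.mem_filter, decide_eq_true_eq]
  exact ⟨fun hx => ⟨h x hx.1 hx.2, hx.2⟩, fun hx => ⟨h' x hx.1 hx.2, hx.2⟩⟩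

lemma pairwise_map_range {n : ℕ} {f : ℕ → ℤ} (hf : StrictAnti f) :
    ((List.range n).map f).Pairwise (· > ·) :=
  List.pairwise_map.2 (List.pairwise_lt_range.imp fun h => hf h)

namespace SerreFamily

variable {k A : Type*} [Field k] [Ring A] [Algebra k A] (S : SerreFamily k A)

lemma row_eq_prod (b : ℤ) (ν : ℤ → ℕ) (n : ℕ) :
    S.row b ν n = ((List.range n).map fun i : ℕ => S.T (b - i) b ^ ν (b - i)).prod := by
  induction n with
  | zero => rfl
  | succ n ih => rw [row, ih, List.prod_range_succ]

lemma pbw_eq_prod (m : ℕ → ℤ → ℕ) (B : ℕ) :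
    S.pbw m B = ((List.range B).reverse.map fun b : ℕ => S.row b (m b) (2 * b + 2)).prod := by
  induction B with
  | zero => rfl
  | succ B ih => simp [pbw, ih, List.range_succ]

end SerreFamily

variable {bar : U →+* U}

variable (bar) in
/-- Equality up to a nonzero bar-invariant scalar. -/
def ScalarEq (x y : U) : Prop := ∃ κ, BarFixed bar κ ∧ x = κ • y

lemma ScalarEq.mul {x y x' y' : U} (h : ScalarEq bar x y) (h' : ScalarEq bar x' y') :
    ScalarEq bar (x * x') (y * y') := by
  obtain ⟨κ, hκ, rfl⟩ := h
  obtain ⟨κ', hκ', rfl⟩ := h'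
  exact ⟨κ * κ', hκ.mul hκ', by rw [smul_mul_smul_comm]⟩

lemma ScalarEq.one : ScalarEq bar 1 1 := ⟨1, .one, (one_smul K (1 : U)).symm⟩

lemma ScalarEq.list_prod {ι : Type*} {l : List ι} {f g : ι → U}
    (h : ∀ x ∈ l, ScalarEq bar (f x) (g x)) : ScalarEq bar (l.map f).prod (l.map g).prod := by
  induction l with
  | nil => exact .one
  | cons a l ih =>
    rw [List.map_cons, List.map_cons, List.prod_cons, List.prod_cons]
    exact (h a List.mem_cons_self).mul (ih fun x hx => h x (List.mem_cons_of_mem _ hx))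

lemma segPowM_zero (i j : ℤ) : segPowM i j 0 = 1 := by
  simp [segPowM, segPow, qfact]

lemma scalarEq_segPowM (hbarq : bar (algebraMap K U q) = algebraMap K U q⁻¹) (i j : ℤ) {n : ℤ}
    (hn : 0 ≤ n) : ScalarEq bar (segPowM i j n) (seg i j ^ n.toNat) := by
  unfold segPowM segPow
  rw [if_neg (not_lt.2 hn), if_neg (not_lt.2 hn)]
  split_ifs
  · refine ⟨_, (BarFixed.prod fun ν => ?_).inv, rfl⟩
    exact_mod_cast BarFixed.qint hbarq (by omega : 2 * (ν + 1) ≠ 0)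
  · refine ⟨_, (BarFixed.prod fun ν => ?_).inv, rfl⟩
    exact_mod_cast BarFixed.qint hbarq (by omega : ν + 1 ≠ 0)

end Products

section Main

lemma natAbs_le_bound {m : MS} {i j : ℤ} (h : m (i, j) ≠ 0) :
    i.natAbs ≤ bound m ∧ j.natAbs ≤ bound m :=
  max_le_iff.1 (Finset.le_sup (f := fun p : ℤ × ℤ => max p.1.natAbs p.2.natAbs)
    (Finsupp.mem_support_iff.2 h))

variable {bar : U →+* U}

lemma scalarEq_pthetaProd (hbarq : bar (algebraMap K U q) = algebraMap K U q⁻¹) {m : MS}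
    (hm : IsTheta m) {B : ℕ} (hB : ∀ i j, m (i, j) ≠ 0 → j < 2 * B + 1) :
    ScalarEq bar (PthetaProd m) (serreFamily.pbw (exponents m) B) := by
  set N := bound m with hN
  set l : List ℤ := (List.range (2 * N + 1)).map fun a : ℕ => (N : ℤ) - a with hl
  have hmem : ∀ x : ℤ, x.natAbs ≤ N → x ∈ l := fun x hx =>
    List.mem_map.2 ⟨(N - x).toNat, List.mem_range.2 (by omega), by omega⟩
  have hlsort : l.Pairwise (· > ·) := pairwise_map_range fun a b h => by
    omega
  have hbox : PthetaProd m =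
      (l.map fun j => (l.map fun i => segPowM i j (m (i, j))).prod).prod := by
    rw [PthetaProd, box, List.map_flatMap, List.flatMap, List.prod_flatten]
    simp [hl, Function.comp_def, hN, ← List.map_eq_flatMap]
  have hne : ∀ {i j}, segPowM i j (m (i, j)) ≠ 1 → m (i, j) ≠ 0 := fun {i j} h h0 =>
    h (by rw [h0, segPowM_zero])
  have hprod : ∀ {j}, (l.map fun i => segPowM i j (m (i, j))).prod ≠ 1 → ∃ i, m (i, j) ≠ 0 := by
    intro j h
    by_contra! h0
    refine h (List.prod_eq_one fun x hx => ?_)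
    obtain ⟨i, -, rfl⟩ := List.mem_map.1 hx
    rw [h0, segPowM_zero]
  have hrows : PthetaProd m = ((List.range B).reverse.map fun b : ℕ =>
      (l.map fun i => segPowM i (2 * b + 1) (m (i, 2 * b + 1))).prod).prod := by
    rw [hbox, prod_map_eq_of_sorted (l' := (List.range B).reverse.map fun b : ℕ => 2 * (b : ℤ) + 1)
      hlsort, List.map_map]
    · rfl
    · exact List.pairwise_map.2 (List.pairwise_reverse.2
        (List.pairwise_lt_range.imp fun h => by omega))
    · intro j _ hj
      obtain ⟨i, hi⟩ := hprod hj
      obtain ⟨-, ⟨b, rfl⟩, h1, h2, -⟩ := hm i j hi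
      have := hB _ _ hi
      exact List.mem_map.2 ⟨b.toNat, by simp; omega, by omega⟩
    · intro j _ hj
      obtain ⟨i, hi⟩ := hprod hj
      exact hmem _ (natAbs_le_bound hi).2
  rw [hrows, serreFamily.pbw_eq_prod]
  refine ScalarEq.list_prod fun b _ => ?_
  rw [serreFamily.row_eq_prod, prod_map_eq_of_sorted
    (l' := (List.range (2 * b + 2)).map fun i : ℕ => 2 * ((b : ℤ) - i) + 1) hlsort
    (pairwise_map_range fun a b h => by omega), List.map_map]
  · refine ScalarEq.list_prod fun i hi => ?_
    have hi := List.mem_range.1 hi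
    have hpos : 0 ≤ m (2 * ((b : ℤ) - i) + 1, 2 * b + 1) := by
      by_contra h
      have := (hm _ _ (by omega : m (2 * ((b : ℤ) - i) + 1, 2 * b + 1) ≠ 0)).2.2.2.2
      omega
    have h := scalarEq_segPowM hbarq (2 * ((b : ℤ) - i) + 1) (2 * b + 1) hpos
    rwa [seg_eq_T (by omega)] at h
  · intro i _ hi
    obtain ⟨⟨c, rfl⟩, -, h1, h2, -⟩ := hm _ _ (hne hi)
    exact List.mem_map.2 ⟨(b - c).toNat, by simp; omega, by omega⟩
  · intro i _ hi
    exact hmem _ (natAbs_le_bound (hne hi)).1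

end Main

/-- Proposition 5.4 of Enomoto–Kashiwara: the bar involution of `Ṽ_θ(0)` (induced by
the unique ℚ-algebra automorphism of `U_q^-(gl_∞)` with `q ↦ q⁻¹`, `f_i ↦ f_i`) is
upper triangular on the PBW basis:
`bar(P_θ(m)φ̃) ∈ P_θ(m)φ̃ + Σ_{m' ∈ M_θ, m' <_cry m} K·P_θ(m')φ̃`. -/
theorem bar_triangular_on_PBW_Vtheta (bar : U →+* U)
    (hbarq : bar (algebraMap K U q) = algebraMap K U q⁻¹)
    (hbarrat : ∀ r : ℚ, bar (algebraMap ℚ U r) = algebraMap ℚ U r)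
    (hbarf : ∀ i : ℤ, Odd i → bar (fgen i) = fgen i)
    (barV : Vt →+ Vt)
    (hbarV : ∀ u : U, barV (Submodule.Quotient.mk u) = Submodule.Quotient.mk (bar u))
    (m : MS) (hm : IsTheta m) :
    barV (Ptheta m • phi) - Ptheta m • phi ∈
      Submodule.span K {v : Vt | ∃ m' : MS, IsTheta m' ∧ CryLt m' m ∧
        v = Ptheta m' • phi} := by
  have hbar := isBar hbarq hbarf
  set B := bound m + 1 with hBdef
  have hB : ∀ i j, m (i, j) ≠ 0 → j < 2 * B + 1 := fun i j h => by
    have := (natAbs_le_bound h).2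
    omega
  obtain ⟨κ, ⟨hκ, hκbar⟩, hP⟩ := scalarEq_pthetaProd (bar := bar) hbarq hm hB
  have hsmul : ∀ x : U, x • phi = (Submodule.Quotient.mk x : Vt) := fun x => by
    rw [phi, ← Submodule.Quotient.mk_smul, smul_eq_mul, mul_one]
  have hmain : barV (Ptheta m • phi) - Ptheta m • phi =
      κ • (bar (serreFamily.pbw (exponents m) B) - serreFamily.pbw (exponents m) B) • phi := by
    rw [Ptheta, if_pos hm, hP, hsmul, hsmul, hbarV, Algebra.smul_def, map_mul, hκbar,
      ← Algebra.smul_def, ← Algebra.smul_def, ← Submodule.Quotient.mk_sub]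
    exact congrArg (Submodule.Quotient.mk (p := Jideal)) (smul_sub κ _ _).symm
  rw [hmain]
  refine Submodule.smul_mem _ _ (Submodule.span_le.2 ?_
    (SerreFamily.bar_pbw_sub_smul_mem F_smul_phi hbar (exponents m) B))
  rintro _ ⟨m', hlt, rfl⟩
  have hm' := isTheta_ofExponents B m'
  obtain ⟨μ, ⟨hμ, -⟩, hP'⟩ :=
    scalarEq_pthetaProd (bar := bar) hbarq hm' (B := B) fun i j h => ofExponents_lt_row h
  have hcry := cryLt_ofExponents hlt
  rw [ofExponents_exponents hm hB] at hcry
  have hpbw : serreFamily.pbw m' B = μ⁻¹ • Ptheta (ofExponents B m') := by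
    rw [Ptheta, if_pos hm', hP', smul_smul, inv_mul_cancel₀ hμ, one_smul]
    refine SerreFamily.pbw_congr fun b hb c hc hcb => ?_
    rw [exponents, ofExponents_odd _ hb hc hcb, Int.toNat_natCast]
  rw [hpbw, smul_assoc]
  exact Submodule.smul_mem _ _ (Submodule.subset_span ⟨_, hm', hcry, rfl⟩)

end
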